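/- Let X be a compact metric space, T : X → X a surjective continuous (non-invertible) map, f ∈ C(X,ℝ), and μ an ergodic T-invariant Borel probability measure with h_μ(T) > 0. Then for μ-almost every x ∈ X, lim_{ε→0} P_s(T,f,x,ε) ≥ P_μ(T,f). -/

import Mathlib

open Filter Set Topology MeasureTheory

noncomputable section

variable {X : Type*}

/-- Birkhoff sum `f_n(x) = ∑_{j<n} f(T^j x)`. -/
def birk (T : X → X) (f : X → ℝ) (n : ℕ) (x : X) : ℝ :=
  ∑ j ∈ Finset.range n, f (T^[j] x)

/-- `P_n(T,f,δ,K)`: supremum of `∑_{x∈E} exp f_n(x)` over `(n,δ)`-separated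
subsets `E ⊆ K`. -/
def sepPn [MetricSpace X] (T : X → X) (f : X → ℝ) (n : ℕ) (δ : ℝ) (K : Set X) : ℝ :=
  sSup { r : ℝ | ∃ E : Finset X, ↑E ⊆ K ∧
    (∀ x ∈ E, ∀ y ∈ E, x ≠ y → ∃ i < n, δ < dist (T^[i] x) (T^[i] y)) ∧
    r = ∑ x ∈ E, Real.exp (birk T f n x) }

/-- The topological pressure of `T` for the subset `K`:
`P(T,f,K) = lim_{δ→0} limsup_n (1/n) log P_n(T,f,δ,K)`; since the expression is
nonincreasing in `δ`, the limit is the supremum over `δ > 0`. -/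
def pres [MetricSpace X] (T : X → X) (f : X → ℝ) (K : Set X) : EReal :=
  ⨆ (δ : ℝ) (_ : 0 < δ), atTop.limsup fun n : ℕ =>
    ((Real.log (sepPn T f n δ K) / n : ℝ) : EReal)

/-- The `ε`-stable set `W^s_ε(x,T)`. -/
def epsStable [MetricSpace X] (T : X → X) (ε : ℝ) (x : X) : Set X :=
  { y | ∀ n : ℕ, dist (T^[n] x) (T^[n] y) ≤ ε }

/-- The topological pressure of the preimages of the `ε`-stable set of `x`:
`P_s(T,f,x,ε) = lim_{δ→0} limsup_n (1/n) log P_n(T,f,δ,T^{-n}W^s_ε(x,T))`. -/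
def Ps [MetricSpace X] (T : X → X) (f : X → ℝ) (x : X) (ε : ℝ) : EReal :=
  ⨆ (δ : ℝ) (_ : 0 < δ), atTop.limsup fun n : ℕ =>
    ((Real.log (sepPn T f n δ ((T^[n]) ⁻¹' epsStable T ε x)) / n : ℝ) : EReal)

/-- A finite open cover of `X`. -/
def IsOpenCover [TopologicalSpace X] (𝒰 : Finset (Set X)) : Prop :=
  (∀ U ∈ 𝒰, IsOpen U) ∧ ⋃₀ (𝒰 : Set (Set X)) = univ

/-- A finite Borel cover of `X`. -/
def IsBorelCover [MeasurableSpace X] (𝒱 : Finset (Set X)) : Prop :=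
  (∀ V ∈ 𝒱, MeasurableSet V) ∧ ⋃₀ (𝒱 : Set (Set X)) = univ

/-- `𝒱` refines the iterated cover `𝒰_0^{n-1} = ⋁_{i<n} T^{-i}𝒰`. -/
def RefinesIter (T : X → X) (𝒰 : Finset (Set X)) (n : ℕ) (𝒱 : Finset (Set X)) : Prop :=
  ∀ V ∈ 𝒱, ∃ g : Fin n → Set X, (∀ i, g i ∈ 𝒰) ∧ V ⊆ ⋂ i : Fin n, (T^[(i : ℕ)]) ⁻¹' g i

/-- `P_n(T,f,𝒰,K)`: infimum over finite Borel covers `𝒱` refining `𝒰_0^{n-1}` of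
`∑_{V∈𝒱} sup_{x ∈ V∩K} exp f_n(x)` (an empty summand contributes `0`, which is
`Real.sSup ∅`). -/
def covPn [MeasurableSpace X] (T : X → X) (f : X → ℝ) (𝒰 : Finset (Set X)) (n : ℕ)
    (K : Set X) : ℝ :=
  sInf { r : ℝ | ∃ 𝒱 : Finset (Set X), IsBorelCover 𝒱 ∧ RefinesIter T 𝒰 n 𝒱 ∧
    r = ∑ V ∈ 𝒱, sSup ((fun x => Real.exp (birk T f n x)) '' (V ∩ K)) }

/-- A finite Borel partition of `X`. -/
def IsFinPartition [MeasurableSpace X] (α : Finset (Set X)) : Prop :=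
  (∀ A ∈ α, MeasurableSet A) ∧ ⋃₀ (α : Set (Set X)) = univ ∧
    (α : Set (Set X)).Pairwise Disjoint

/-- `H_μ(⋁_{i<n} T^{-i}α)`, computed over all atoms `⋂_{i<n} T^{-i} A_i`. -/
def dynH [MeasurableSpace X] (μ : Measure X) (T : X → X) (α : Finset (Set X)) (n : ℕ) : ℝ :=
  ∑ g : Fin n → α, Real.negMulLog ((μ (⋂ i : Fin n, (T^[(i : ℕ)]) ⁻¹' (g i : Set X))).toReal)

/-- `h_μ(T,α) = lim_n (1/n) H_μ(α_0^{n-1})`, which for an invariant measure equals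
the infimum of `(1/n) H_μ(α_0^{n-1})` over `n ≥ 1`. -/
def entPart [MeasurableSpace X] (μ : Measure X) (T : X → X) (α : Finset (Set X)) : ℝ :=
  ⨅ n : ℕ, dynH μ T α (n + 1) / (n + 1 : ℝ)

/-- The measure-theoretic entropy `h_μ(T)`. -/
def mEnt [MeasurableSpace X] (μ : Measure X) (T : X → X) : EReal :=
  ⨆ (α : Finset (Set X)) (_ : IsFinPartition α), ((entPart μ T α : ℝ) : EReal)

/-- The measure-theoretic pressure `P_μ(T,f) = h_μ(T) + ∫ f dμ`. -/
def mPres [MeasurableSpace X] (μ : Measure X) (T : X → X) (f : X → ℝ) : EReal :=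
  mEnt μ T + ((∫ x, f x ∂μ : ℝ) : EReal)

/-- The stable set `W^s(x,T)`. -/
def stableSet [MetricSpace X] (T : X → X) (x : X) : Set X :=
  { y | Tendsto (fun n : ℕ => dist (T^[n] x) (T^[n] y)) atTop (𝓝 0) }

/-- A Cantor set: a nonempty compact perfect totally disconnected set. -/
def IsCantorSet [TopologicalSpace X] (C : Set X) : Prop :=
  C.Nonempty ∧ IsCompact C ∧ Perfect C ∧ IsTotallyDisconnected C

/-- A weakly mixing set for `T`. -/
def IsWeaklyMixingSet [TopologicalSpace X] (T : X → X) (A : Set X) : Prop :=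
  A.Nonempty ∧ IsClosed A ∧
  ∃ B : Set X, B ⊆ A ∧
    (∃ C : ℕ → Set X, (∀ n, IsCantorSet (C n)) ∧ B = ⋃ n, C n) ∧
    closure B = A ∧
    ∀ C : Set X, C ⊆ B → IsCantorSet C →
      ∀ g : C → X, Continuous g → (∀ c : C, g c ∈ A) →
        ∃ φ : ℕ → ℕ, StrictMono φ ∧
          ∀ c : C, Tendsto (fun i => T^[φ i] (c : X)) atTop (𝓝 (g c))

section Entropy

variable {κ ι : Type*}

/-- Measurability of a map into a discrete set of labels. -/
def DiscMeas [MeasurableSpace X] (Z : X → κ) : Prop :=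
  ∀ s : Set κ, MeasurableSet (Z ⁻¹' s)

theorem discMeas_of_singleton [MeasurableSpace X] [Finite κ] {Z : X → κ}
    (h : ∀ k, MeasurableSet (Z ⁻¹' {k})) : DiscMeas Z := by
  intro s
  rw [← biUnion_of_singleton s, preimage_iUnion₂]
  exact s.toFinite.measurableSet_biUnion fun k _ => h k

theorem DiscMeas.comp_right [MeasurableSpace X] {Z : X → κ} (hZ : DiscMeas Z) {T : X → X}
    (hT : Measurable T) : DiscMeas (fun x => Z (T x)) := fun s => hT (hZ s)

theorem DiscMeas.prodMk [MeasurableSpace X] [Finite κ] [Finite ι] {Z : X → κ} {W : X → ι}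
    (hZ : DiscMeas Z) (hW : DiscMeas W) : DiscMeas (fun x => (Z x, W x)) := by
  refine discMeas_of_singleton fun k => ?_
  convert (hZ {k.1}).inter (hW {k.2}) using 1
  ext x
  simp [Prod.ext_iff]

/-- The distribution of a label map has total mass one over any exhaustive set of labels. -/
theorem sum_real_fiber [MeasurableSpace X] (μ : Measure X) [IsFiniteMeasure μ] {Z : X → κ}
    (hZ : DiscMeas Z) (s : Finset κ) :
    ∑ k ∈ s, μ.real (Z ⁻¹' {k}) = μ.real (Z ⁻¹' (s : Set κ)) :=
  sum_measureReal_preimage_singleton s fun k _ => hZ {k}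

variable [Fintype κ] [Fintype ι]

/-- Shannon entropy of a label map. -/
def ent [MeasurableSpace X] (μ : Measure X) (Z : X → κ) : ℝ :=
  ∑ k, Real.negMulLog (μ.real (Z ⁻¹' {k}))

theorem negMulLog_sum_le {β : Type*} (s : Finset β) (p : β → ℝ) (hp : ∀ b ∈ s, 0 ≤ p b) :
    Real.negMulLog (∑ b ∈ s, p b) ≤ ∑ b ∈ s, Real.negMulLog (p b) := by
  simp only [Real.negMulLog, neg_mul, Finset.sum_neg_distrib, neg_le_neg_iff]
  rw [Finset.sum_mul]
  refine Finset.sum_le_sum fun b hb => ?_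
  rcases (hp b hb).eq_or_lt with h | h
  · simp [← h]
  · exact mul_le_mul_of_nonneg_left
      (Real.log_le_log h (Finset.single_le_sum hp hb)) h.le

/-- The log-sum (Gibbs) inequality. -/
theorem sum_negMulLog_add_le {β : Type*} (s : Finset β) (p e : β → ℝ) {P : ℝ}
    (hp : ∀ b ∈ s, 0 < p b) (hP : 0 < P) (he : ∑ b ∈ s, Real.exp (e b) ≤ P) :
    ∑ b ∈ s, (Real.negMulLog (p b) + p b * e b) ≤
      Real.negMulLog (∑ b ∈ s, p b) + (∑ b ∈ s, p b) * Real.log P := by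
  set q := ∑ b ∈ s, p b with hq
  rcases s.eq_empty_or_nonempty with rfl | hs
  · simp [hq]
  have hq0 : 0 < q := Finset.sum_pos hp hs
  have key : ∀ b ∈ s, Real.negMulLog (p b) + p b * e b - p b * (Real.log P - Real.log q)
      ≤ Real.exp (e b) * (q / P) - p b := by
    intro b hb
    have hb0 := hp b hb
    have h1 := Real.log_le_sub_one_of_pos
      (show 0 < Real.exp (e b) * (q / P) / p b by positivity)
    rw [Real.log_div (by positivity) hb0.ne', Real.log_mul (by positivity) (by positivity),
      Real.log_exp, Real.log_div hq0.ne' hP.ne'] at h1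
    have h2 := mul_le_mul_of_nonneg_left h1 hb0.le
    have h3 : p b * (Real.exp (e b) * (q / P) / p b - 1) = Real.exp (e b) * (q / P) - p b := by
      field_simp
    rw [h3] at h2
    simp only [Real.negMulLog]
    linarith
  have hsum := Finset.sum_le_sum key
  rw [Finset.sum_sub_distrib, Finset.sum_sub_distrib, ← Finset.sum_mul, ← Finset.sum_mul,
    ← hq] at hsum
  have h4 : (∑ b ∈ s, Real.exp (e b)) * (q / P) ≤ q := by
    calc _ ≤ P * (q / P) := by gcongr
      _ = q := by field_simp
  simp only [Real.negMulLog] at hsum ⊢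
  linarith

theorem ent_comp_le [MeasurableSpace X] (μ : Measure X) [IsFiniteMeasure μ] {Z : X → κ}
    (hZ : DiscMeas Z) (φ : κ → ι) : ent μ (fun x => φ (Z x)) ≤ ent μ Z := by
  classical
  unfold ent
  rw [← Finset.sum_fiberwise (Finset.univ : Finset κ) φ]
  refine Finset.sum_le_sum fun l _ => ?_
  have h := negMulLog_sum_le (Finset.univ.filter fun k => φ k = l)
    (fun k => μ.real (Z ⁻¹' {k})) (fun _ _ => measureReal_nonneg)
  rw [sum_real_fiber μ hZ] at h
  refine (le_of_eq (congrArg _ (congrArg _ ?_))).trans h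
  ext x
  simp

theorem ent_comp_measurePreserving [MeasurableSpace X] {μ : Measure X} {T : X → X}
    (hT : MeasurePreserving T μ μ) {Z : X → κ} (hZ : DiscMeas Z) :
    ent μ (fun x => Z (T x)) = ent μ Z :=
  Finset.sum_congr rfl fun k _ => by
    rw [← hT.measureReal_preimage (hZ {k}).nullMeasurableSet]
    rfl

theorem sum_real_fiber_prod [MeasurableSpace X] (μ : Measure X) [IsFiniteMeasure μ] {U : X → κ}
    {V : X → ι} (hU : DiscMeas U) (hV : DiscMeas V) (u : κ) :
    ∑ v, μ.real ((fun x => (U x, V x)) ⁻¹' {(u, v)}) = μ.real (U ⁻¹' {u}) := by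
  classical
  have := sum_real_fiber μ (hU.prodMk hV) (Finset.univ.map ⟨fun v : ι => (u, v),
    fun a b h => (Prod.ext_iff.1 h).2⟩)
  rw [Finset.sum_map] at this
  refine this.trans (congrArg _ ?_)
  ext x
  simp only [Finset.coe_map, Finset.coe_univ, image_univ, mem_preimage, mem_range,
    mem_singleton_iff]
  exact ⟨fun ⟨_, h⟩ => (Prod.ext_iff.1 h).1.symm, fun h => ⟨V x, Prod.ext h.symm rfl⟩⟩

theorem ent_prod_le [MeasurableSpace X] (μ : Measure X) [IsProbabilityMeasure μ] {U : X → κ}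
    {V : X → ι} (hU : DiscMeas U) (hV : DiscMeas V) :
    ent μ (fun x => (U x, V x)) ≤ ent μ U + ent μ V := by
  classical
  set p : κ → ι → ℝ := fun u v => μ.real ((fun x => (U x, V x)) ⁻¹' {(u, v)}) with hp
  set q : ι → ℝ := fun v => μ.real (V ⁻¹' {v}) with hq
  have hp0 : ∀ u v, 0 ≤ p u v := fun _ _ => measureReal_nonneg
  have hpq : ∀ u v, p u v ≤ q v := fun u v => measureReal_mono (fun x hx => by
    simp only [mem_preimage, mem_singleton_iff, Prod.ext_iff] at hx ⊢
    exact hx.2)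
  have hrow : ∀ u, ∑ v, p u v = μ.real (U ⁻¹' {u}) := sum_real_fiber_prod μ hU hV
  have hcol : ∀ v, ∑ u, p u v = q v := fun v => by
    refine Eq.trans ?_ (sum_real_fiber_prod μ hV hU v)
    refine Finset.sum_congr rfl fun u _ => congrArg μ.real ?_
    ext x
    simp [and_comm]
  have key : ∀ u, ∑ v, (Real.negMulLog (p u v) + p u v * Real.log (q v)) ≤
      Real.negMulLog (μ.real (U ⁻¹' {u})) := by
    intro u
    set s : Finset ι := Finset.univ.filter fun v => p u v ≠ 0 with hs
    have hpos : ∀ v ∈ s, 0 < p u v := fun v hv =>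
      lt_of_le_of_ne (hp0 u v) (Ne.symm (by simpa [hs] using hv))
    have hout : ∀ v, v ∉ s → p u v = 0 := fun v hv => by simpa [hs] using hv
    have hsub : ∀ g : ι → ℝ, (∀ v, v ∉ s → g v = 0) → ∑ v ∈ s, g v = ∑ v, g v := fun g hg =>
      Finset.sum_subset (Finset.subset_univ s) fun v _ hv => hg v hv
    have h := sum_negMulLog_add_le s (p u) (fun v => Real.log (q v)) hpos one_pos (by
      calc ∑ v ∈ s, Real.exp (Real.log (q v)) = ∑ v ∈ s, q v :=
            Finset.sum_congr rfl fun v hv => Real.exp_log ((hpos v hv).trans_le (hpq u v))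
        _ = μ.real (V ⁻¹' (s : Set ι)) := sum_real_fiber μ hV s
        _ ≤ 1 := measureReal_le_one)
    rw [hsub _ fun v hv => by simp [hout v hv], hsub _ hout, hrow] at h
    simpa using h
  have hsum := Finset.sum_le_sum fun u (_ : u ∈ Finset.univ) => key u
  simp only [Finset.sum_add_distrib] at hsum
  rw [Finset.sum_comm (f := fun u v => p u v * Real.log (q v))] at hsum
  simp only [← Finset.sum_mul, hcol] at hsum
  have h1 : ent μ (fun x => (U x, V x)) = ∑ u, ∑ v, Real.negMulLog (p u v) :=
    Fintype.sum_prod_type _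
  have h2 : ent μ V = -∑ v, q v * Real.log (q v) := by
    simp [ent, Real.negMulLog, hq]
  rw [h1, h2]
  unfold ent
  linarith

/-- Variational inequality for a function `F` relative to the partitions given by `U` and `V`:
the conditional entropy of `V` given `U`, plus `∫ F`, is bounded by the average over `U` of the
log of sums of `exp F` over sets meeting each atom of `V` at most once. -/
theorem ent_add_integral_le [MeasurableSpace X] (μ : Measure X) [IsProbabilityMeasure μ] {U : X → κ}
    {V : X → ι} (hU : DiscMeas U) (hV : DiscMeas V) {F : X → ℝ} (hF : Integrable F μ)
    {B : ℝ} (hB : ∀ x, F x ≤ B) (P : κ → ℝ) (hP0 : ∀ u, 0 < P u)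
    (hP : ∀ (u : κ) (E : Finset X), (∀ x ∈ E, U x = u) → (∀ x ∈ E, ∀ y ∈ E, V x = V y → x = y) →
      ∑ x ∈ E, Real.exp (F x) ≤ P u) :
    ent μ (fun x => (U x, V x)) + ∫ x, F x ∂μ ≤
      ent μ U + ∑ u, μ.real (U ⁻¹' {u}) * Real.log (P u) + 1 := by
  classical
  set c : κ → ι → Set X := fun u v => (fun x => (U x, V x)) ⁻¹' {(u, v)} with hc
  have hmem : ∀ {u v x}, x ∈ c u v ↔ U x = u ∧ V x = v := by
    intro u v x
    simp [hc]
  set p : κ → ι → ℝ := fun u v => μ.real (c u v) with hp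
  have hp0 : ∀ u v, 0 ≤ p u v := fun _ _ => measureReal_nonneg
  have hrow : ∀ u, ∑ v, p u v = μ.real (U ⁻¹' {u}) := sum_real_fiber_prod μ hU hV
  have hcm : ∀ u v, MeasurableSet (c u v) := fun u v => hU.prodMk hV {(u, v)}
  have hpt : ∀ u v, ∃ e : ℝ, ((c u v).Nonempty → ∃ x ∈ c u v, F x = e) ∧
      ∀ x ∈ c u v, F x ≤ e + 1 := by
    intro u v
    rcases (c u v).eq_empty_or_nonempty with h | h
    · exact ⟨0, by simp [h]⟩
    · have hbd : BddAbove (F '' c u v) := ⟨B, by rintro _ ⟨x, _, rfl⟩; exact hB x⟩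
      obtain ⟨_, ⟨x, hx, rfl⟩, hlt⟩ := exists_lt_of_lt_csSup (h.image F)
        (show sSup (F '' c u v) - 1 < sSup (F '' c u v) by linarith)
      refine ⟨F x, fun _ => ⟨x, hx, rfl⟩, fun y hy => ?_⟩
      have := le_csSup hbd (mem_image_of_mem F hy)
      linarith
  choose e he1 he2 using hpt
  have hne : ∀ {u v}, p u v ≠ 0 → (c u v).Nonempty := fun {u v} h => by
    by_contra h'
    rw [not_nonempty_iff_eq_empty] at h'
    exact h (by simp [hp, h'])
  have key : ∀ u, ∑ v, (Real.negMulLog (p u v) + p u v * e u v) ≤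
      Real.negMulLog (μ.real (U ⁻¹' {u})) + μ.real (U ⁻¹' {u}) * Real.log (P u) := by
    intro u
    set s : Finset ι := Finset.univ.filter fun v => p u v ≠ 0 with hs
    have hs0 : ∀ v ∈ s, p u v ≠ 0 := fun v hv => by simpa [hs] using hv
    have hout : ∀ v, v ∉ s → p u v = 0 := fun v hv => by simpa [hs] using hv
    have hsub : ∀ g : ι → ℝ, (∀ v, v ∉ s → g v = 0) → ∑ v ∈ s, g v = ∑ v, g v := fun g hg =>
      Finset.sum_subset (Finset.subset_univ s) fun v _ hv => hg v hv
    have hx : ∀ v : s, ∃ x ∈ c u v, F x = e u v := fun v => he1 u v (hne (hs0 v v.2))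
    choose x hxc hxe using hx
    have hxV : ∀ v, V (x v) = v := fun v => (hmem.1 (hxc v)).2
    have hinj : Function.Injective x := fun v w h => Subtype.ext (by rw [← hxV v, ← hxV w, h])
    have h := sum_negMulLog_add_le s (p u) (e u)
      (fun v hv => lt_of_le_of_ne (hp0 u v) (hs0 v hv).symm) (hP0 u) (by
        refine le_trans (le_of_eq ?_) (hP u (Finset.univ.map ⟨x, hinj⟩) ?_ ?_)
        · rw [Finset.sum_map, ← Finset.sum_coe_sort s]
          exact Finset.sum_congr rfl fun v _ => by simp [hxe]
        · simp only [Finset.mem_map, Finset.mem_univ, true_and, Function.Embedding.coeFn_mk]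
          rintro _ ⟨v, rfl⟩
          exact (hmem.1 (hxc v)).1
        · simp only [Finset.mem_map, Finset.mem_univ, true_and, Function.Embedding.coeFn_mk]
          rintro _ ⟨v, rfl⟩ _ ⟨w, rfl⟩ hvw
          rw [hxV, hxV] at hvw
          rw [Subtype.ext hvw])
    rw [hsub _ fun v hv => by simp [hout v hv], hsub _ hout, hrow] at h
    exact h
  have hint : ∫ x, F x ∂μ ≤ ∑ u, ∑ v, p u v * (e u v + 1) := by
    have hun : (⋃ k : κ × ι, c k.1 k.2) = univ := eq_univ_of_forall fun x =>
      mem_iUnion.2 ⟨(U x, V x), hmem.2 ⟨rfl, rfl⟩⟩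
    rw [← setIntegral_univ, ← hun, integral_iUnion_fintype (fun k : κ × ι => hcm k.1 k.2) ?_
      (fun k => hF.integrableOn), Fintype.sum_prod_type]
    · refine Finset.sum_le_sum fun u _ => Finset.sum_le_sum fun v _ => ?_
      calc ∫ x in c u v, F x ∂μ ≤ ∫ x in c u v, (e u v + 1) ∂μ :=
            setIntegral_mono_on hF.integrableOn (integrable_const _).integrableOn (hcm u v)
              (he2 u v)
        _ = p u v * (e u v + 1) := by simp [hp]
    · rintro ⟨u, v⟩ ⟨u', v'⟩ hne'
      refine disjoint_left.2 fun x hx hx' => hne' ?_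
      exact Prod.ext ((hmem.1 hx).1.symm.trans (hmem.1 hx').1)
        ((hmem.1 hx).2.symm.trans (hmem.1 hx').2)
  have htot : ∑ u, ∑ v, p u v = 1 := by
    simp only [hrow]
    rw [sum_real_fiber μ hU]
    simp
  have hsum := Finset.sum_le_sum fun u (_ : u ∈ Finset.univ) => key u
  simp only [Finset.sum_add_distrib] at hsum
  simp only [mul_add, mul_one, Finset.sum_add_distrib, htot] at hint
  have h1 : ent μ (fun x => (U x, V x)) = ∑ u, ∑ v, Real.negMulLog (p u v) :=
    Fintype.sum_prod_type _
  rw [h1]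
  unfold ent
  linarith

end Entropy

section Separated

theorem abs_birk_le {T : X → X} {f : X → ℝ} {B : ℝ} (hB : ∀ x, |f x| ≤ B) (n : ℕ) (x : X) :
    |birk T f n x| ≤ n * B := by
  refine (Finset.abs_sum_le_sum_abs _ _).trans ?_
  simpa using Finset.sum_le_card_nsmul (Finset.range n) (fun j => |f (T^[j] x)|) B
    fun j _ => hB _

theorem continuous_birk [TopologicalSpace X] {T : X → X} (hT : Continuous T) {f : X → ℝ}
    (hf : Continuous f) (n : ℕ) : Continuous (birk T f n) :=
  continuous_finsetSum _ fun j _ => hf.comp (hT.iterate j)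

theorem integral_birk [TopologicalSpace X] [CompactSpace X] [MeasurableSpace X] [BorelSpace X]
    {T : X → X} {μ : Measure X} [IsFiniteMeasure μ] (hT : Continuous T)
    (hμ : MeasurePreserving T μ μ) (f : C(X, ℝ)) (n : ℕ) :
    ∫ x, birk T f n x ∂μ = n * ∫ x, f x ∂μ := by
  have hint : ∀ g : X → ℝ, Continuous g → Integrable g μ := fun g hg =>
    hg.integrable_of_hasCompactSupport (HasCompactSupport.of_compactSpace g)
  unfold birk
  rw [integral_finsetSum (Finset.range n) (f := fun j x => f (T^[j] x))
    fun j _ => hint _ (f.continuous.comp (hT.iterate j))]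
  have : ∀ j ∈ Finset.range n, ∫ x, f (T^[j] x) ∂μ = ∫ x, f x ∂μ := fun j _ => by
    have hj := hμ.iterate j
    rw [← integral_map hj.measurable.aemeasurable
      f.continuous.measurable.aestronglyMeasurable, hj.map_eq]
  rw [Finset.sum_congr rfl this]
  simp

variable [MetricSpace X]

/-- `(n,δ)`-separated finite sets. -/
def IsSepFinset (T : X → X) (n : ℕ) (δ : ℝ) (E : Finset X) : Prop :=
  ∀ x ∈ E, ∀ y ∈ E, x ≠ y → ∃ i < n, δ < dist (T^[i] x) (T^[i] y)

theorem exists_card_sep_le [CompactSpace X] {δ : ℝ} (hδ : 0 < δ) (T : X → X) :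
    ∃ N : ℕ, 0 < N ∧ ∀ n E, IsSepFinset T n δ E → E.card ≤ N ^ n := by
  classical
  obtain ⟨t, -, htf, ht⟩ := (isCompact_univ (X := X)).finite_cover_balls (half_pos hδ)
  have hc : ∀ x, ∃ c ∈ htf.toFinset, dist x c < δ / 2 := fun x => by
    simpa using ht (mem_univ x)
  choose c hct hcd using hc
  refine ⟨htf.toFinset.card + 1, Nat.succ_pos _, fun n E hE => ?_⟩
  calc E.card ≤ (Fintype.piFinset fun _ : Fin n => htf.toFinset).card := by
        refine Finset.card_le_card_of_injOn (fun x i => c (T^[(i : ℕ)] x))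
          (fun x _ => by simp only [Finset.mem_coe, Fintype.mem_piFinset]; exact fun i => hct _) ?_
        intro x hx y hy hxy
        by_contra hne
        obtain ⟨i, hi, hd⟩ := hE x hx y hy hne
        have h1 : c (T^[i] x) = c (T^[i] y) := congrFun hxy ⟨i, hi⟩
        have h2 := hcd (T^[i] x)
        have h3 := hcd (T^[i] y)
        rw [h1] at h2
        have := dist_triangle_right (T^[i] x) (T^[i] y) (c (T^[i] y))
        linarith
    _ = htf.toFinset.card ^ n := by simp
    _ ≤ _ := Nat.pow_le_pow_left (Nat.le_succ _) n

/-- Exponential upper bound, uniform over all `n` and all separated sets. -/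
theorem exists_sum_sep_le [CompactSpace X] {δ : ℝ} (hδ : 0 < δ) (T : X → X) {f : X → ℝ} {B : ℝ}
    (hB : ∀ x, |f x| ≤ B) :
    ∃ M : ℝ, ∀ n E, IsSepFinset T n δ E →
      ∑ x ∈ E, Real.exp (birk T f n x) ≤ Real.exp (n * M) := by
  obtain ⟨N, hN, hcard⟩ := exists_card_sep_le hδ T
  refine ⟨Real.log N + B, fun n E hE => ?_⟩
  have h1 := Finset.sum_le_card_nsmul E (fun x => Real.exp (birk T f n x)) (Real.exp (n * B))
    fun x _ => Real.exp_le_exp.2 ((le_abs_self _).trans (abs_birk_le hB n x))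
  refine h1.trans ?_
  rw [nsmul_eq_mul, mul_add, Real.exp_add, Real.exp_nat_mul (Real.log N),
    Real.exp_log (by exact_mod_cast hN)]
  gcongr
  exact_mod_cast hcard n E hE

theorem sepPn_bddAbove [CompactSpace X] {δ : ℝ} (hδ : 0 < δ) (T : X → X) {f : X → ℝ} {B : ℝ}
    (hB : ∀ x, |f x| ≤ B) (n : ℕ) (K : Set X) :
    BddAbove { r : ℝ | ∃ E : Finset X, ↑E ⊆ K ∧
      (∀ x ∈ E, ∀ y ∈ E, x ≠ y → ∃ i < n, δ < dist (T^[i] x) (T^[i] y)) ∧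
      r = ∑ x ∈ E, Real.exp (birk T f n x) } := by
  obtain ⟨M, hM⟩ := exists_sum_sep_le hδ T hB
  refine ⟨Real.exp (n * M), ?_⟩
  rintro _ ⟨E, -, hE, rfl⟩
  exact hM n E hE

theorem sum_le_sepPn [CompactSpace X] {δ : ℝ} (hδ : 0 < δ) {T : X → X} {f : X → ℝ} {B : ℝ}
    (hB : ∀ x, |f x| ≤ B) {n : ℕ} {K : Set X} {E : Finset X} (hEK : ↑E ⊆ K)
    (hE : IsSepFinset T n δ E) : ∑ x ∈ E, Real.exp (birk T f n x) ≤ sepPn T f n δ K :=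
  le_csSup (sepPn_bddAbove hδ T hB n K) ⟨E, hEK, hE, rfl⟩

theorem sepPn_le {δ : ℝ} {T : X → X} {f : X → ℝ} {n : ℕ} {K : Set X} {R : ℝ}
    (h : ∀ E : Finset X, ↑E ⊆ K → IsSepFinset T n δ E →
      ∑ x ∈ E, Real.exp (birk T f n x) ≤ R) : sepPn T f n δ K ≤ R := by
  refine csSup_le ⟨0, ∅, by simp, by simp, by simp⟩ ?_
  rintro _ ⟨E, h1, h2, rfl⟩
  exact h E h1 h2

theorem sepPn_mono [CompactSpace X] {δ : ℝ} (hδ : 0 < δ) {T : X → X} {f : X → ℝ} {B : ℝ}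
    (hB : ∀ x, |f x| ≤ B) (n : ℕ) {K L : Set X} (hKL : K ⊆ L) :
    sepPn T f n δ K ≤ sepPn T f n δ L :=
  sepPn_le fun _ hEK hE => sum_le_sepPn hδ hB (hEK.trans hKL) hE

theorem sepPn_pos [CompactSpace X] {δ : ℝ} (hδ : 0 < δ) {T : X → X} {f : X → ℝ} {B : ℝ}
    (hB : ∀ x, |f x| ≤ B) (n : ℕ) {K : Set X} (hK : K.Nonempty) : 0 < sepPn T f n δ K := by
  obtain ⟨x, hx⟩ := hK
  refine lt_of_lt_of_le ?_ (sum_le_sepPn hδ hB (E := {x}) (by simpa using hx)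
    (by intro a ha b hb hab; simp_all))
  simp [Real.exp_pos]

/-- Pushing a base point forward by `T^k` changes the separated sums over preimages of its
`ε`-stable set by at most a factor depending on `k` only. -/
theorem sepPn_iterate_ge [CompactSpace X] {δ : ℝ} (hδ : 0 < δ) {T : X → X} {f : X → ℝ} {B : ℝ}
    (hB : ∀ x, |f x| ≤ B) (n k : ℕ) (ε : ℝ) (x : X) :
    Real.exp (-(k * B)) * sepPn T f n δ (T^[n] ⁻¹' epsStable T ε x) ≤
      sepPn T f (n + k) δ (T^[n + k] ⁻¹' epsStable T ε (T^[k] x)) := by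
  rw [Real.exp_neg, ← div_eq_inv_mul, div_le_iff₀ (Real.exp_pos _)]
  refine sepPn_le fun E hEK hE => ?_
  have hsub : ↑E ⊆ T^[n + k] ⁻¹' epsStable T ε (T^[k] x) := fun y hy j => by
    have := hEK hy (j + k)
    rwa [← Function.iterate_add_apply, ← Function.iterate_add_apply, add_comm n k, ← add_assoc,
      Function.iterate_add_apply T (j + k) n]
  have hsep : IsSepFinset T (n + k) δ E := fun a ha b hb hab => by
    obtain ⟨i, hi, hd⟩ := hE a ha b hb hab
    exact ⟨i, by omega, hd⟩
  refine le_trans ?_ (mul_le_mul_of_nonneg_right (sum_le_sepPn hδ hB hsub hsep)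
    (Real.exp_pos _).le)
  rw [Finset.sum_mul]
  refine Finset.sum_le_sum fun y _ => ?_
  rw [← Real.exp_add, Real.exp_le_exp]
  have h1 : birk T f (n + k) y = birk T f n y + birk T f k (T^[n] y) := by
    simp only [birk, Finset.sum_range_add, ← Function.iterate_add_apply, add_comm]
  have h2 := neg_le_of_abs_le (abs_birk_le hB k (T^[n] y) (T := T))
  linarith

/-- Separated sums over a compact set nearly attain those over its neighbourhoods. -/
theorem exists_nhds_sum_le_sepPn [CompactSpace X] {δ : ℝ} (hδ : 0 < δ) {T : X → X}
    (hT : Continuous T) {f : X → ℝ} (hf : Continuous f) {B : ℝ} (hB : ∀ x, |f x| ≤ B) (n : ℕ)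
    (K : Set X) :
    ∃ U, IsOpen U ∧ K ⊆ U ∧
      sepPn T f n δ U ≤ Real.exp 1 * sepPn T f n (δ / 2) K := by
  classical
  have huc : ∀ i, UniformContinuous T^[i] := fun i =>
    CompactSpace.uniformContinuous_of_continuous (hT.iterate i)
  have hub : UniformContinuous (birk T f n) :=
    CompactSpace.uniformContinuous_of_continuous (continuous_birk hT hf n)
  obtain ⟨θ₀, hθ₀, hb⟩ := Metric.uniformContinuous_iff.1 hub 1 one_pos
  have hev : ∀ᶠ θ in 𝓝[>] (0 : ℝ), ∀ i ∈ Finset.range n,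
      ∀ a b, dist a b < θ → dist (T^[i] a) (T^[i] b) < δ / 4 := by
    rw [Finset.eventually_all]
    intro i _
    obtain ⟨θ, hθ, h⟩ := Metric.uniformContinuous_iff.1 (huc i) (δ / 4) (by positivity)
    filter_upwards [Ioo_mem_nhdsGT hθ] with θ' hθ' a b hab
    exact h (hab.trans hθ'.2)
  obtain ⟨θ, hθ, hθlt⟩ := (hev.and (Ioo_mem_nhdsGT hθ₀)).exists
  refine ⟨Metric.thickening θ K, Metric.isOpen_thickening,
    Metric.self_subset_thickening hθlt.1 K, sepPn_le fun E hEU hE => ?_⟩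
  have hr : ∀ y ∈ E, ∃ z ∈ K, dist y z < θ := fun y hy =>
    Metric.mem_thickening_iff.1 (hEU hy)
  choose! r hrK hrd using hr
  have hsepr : ∀ a ∈ E, ∀ b ∈ E, a ≠ b → ∃ i < n, δ / 2 < dist (T^[i] (r a)) (T^[i] (r b)) := by
    intro a ha b hb hab
    obtain ⟨i, hi, hd⟩ := hE a ha b hb hab
    refine ⟨i, hi, ?_⟩
    have h1 := hθ i (Finset.mem_range.2 hi) _ _ (hrd a ha)
    have h2 := hθ i (Finset.mem_range.2 hi) _ _ (hrd b hb)
    have h3 := dist_triangle4 (T^[i] a) (T^[i] (r a)) (T^[i] (r b)) (T^[i] b)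
    rw [dist_comm (T^[i] (r b))] at h3
    linarith
  have hinj : ∀ a ∈ E, ∀ b ∈ E, r a = r b → a = b := by
    intro a ha b hb hab
    by_contra hne
    obtain ⟨i, -, hd⟩ := hsepr a ha b hb hne
    rw [hab, dist_self] at hd
    linarith
  have hle := sum_le_sepPn (half_pos hδ) hB (T := T) (n := n) (K := K) (E := E.image r)
    (by
      intro z hz
      obtain ⟨y, hy, rfl⟩ := Finset.mem_image.1 (Finset.mem_coe.1 hz)
      exact hrK y hy)
    (by
      intro a ha b hb hab
      obtain ⟨a, ha', rfl⟩ := Finset.mem_image.1 ha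
      obtain ⟨b, hb', rfl⟩ := Finset.mem_image.1 hb
      exact hsepr a ha' b hb' fun h => hab (by rw [h]))
  rw [Finset.sum_image fun a ha b hb => hinj a ha b hb] at hle
  refine le_trans ?_ (mul_le_mul_of_nonneg_left hle (Real.exp_pos _).le)
  rw [Finset.mul_sum]
  refine Finset.sum_le_sum fun y hy => ?_
  rw [← Real.exp_add, Real.exp_le_exp]
  have := hb ((hrd y hy).trans hθlt.2)
  rw [Real.dist_eq] at this
  linarith [(abs_lt.1 this).2]

/-- A lower bound for the separated sums over all finite-time approximations of the
`ε`-stable set passes to the `ε`-stable set itself. -/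
theorem le_sepPn_epsStable [CompactSpace X] {δ : ℝ} (hδ : 0 < δ) {T : X → X}
    (hT : Continuous T) {f : X → ℝ} (hf : Continuous f) {B : ℝ} (hB : ∀ x, |f x| ≤ B) (n : ℕ)
    (ε : ℝ) (x : X) {R : ℝ}
    (h : ∀ m, R ≤ sepPn T f n δ
      (T^[n] ⁻¹' {y | ∀ i < m, dist (T^[i] x) (T^[i] y) ≤ ε})) :
    R ≤ Real.exp 1 * sepPn T f n (δ / 2) (T^[n] ⁻¹' epsStable T ε x) := by
  obtain ⟨U, hUo, hKU, hU⟩ := exists_nhds_sum_le_sepPn hδ hT hf hB n (T^[n] ⁻¹' epsStable T ε x)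
  set V : ℕ → Set X := fun m => T^[n] ⁻¹' {y | ∀ i < m, dist (T^[i] x) (T^[i] y) ≤ ε} with hV
  have hVc : ∀ m, IsClosed (V m) := fun m => by
    refine IsClosed.preimage (hT.iterate n) ?_
    simp only [ofPred_forall]
    exact isClosed_iInter fun i => isClosed_iInter fun _ =>
      isClosed_le (continuous_const.dist (hT.iterate i)) continuous_const
  have hVa : Antitone V := fun m m' hm y hy i hi => hy i (hi.trans_le hm)
  obtain ⟨m, hm⟩ := exists_subset_nhds_of_isCompact (V := V)
    (directed_of_isDirected_le fun _ _ h => hVa h) (fun m => (hVc m).isCompact)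
    (U := U) (fun y hy => hUo.mem_nhds (hKU fun i => mem_iInter.1 hy (i + 1) i (Nat.lt_succ_self i)))
  exact (h m).trans ((sepPn_mono hδ hB n hm).trans hU)

end Separated

section Names

variable {κ : Type*}

/-- The `n`-name of a point with respect to a labelling `A`. -/
def orbitName (T : X → X) (A : X → κ) (n : ℕ) (x : X) : Fin n → κ :=
  fun i => A (T^[(i : ℕ)] x)

theorem orbitName_eq_iff {T : X → X} {A : X → κ} {n : ℕ} {x y : X} :
    orbitName T A n x = orbitName T A n y ↔ ∀ i < n, A (T^[i] x) = A (T^[i] y) :=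
  ⟨fun h i hi => congrFun h ⟨i, hi⟩, fun h => funext fun i => h i i.2⟩

theorem orbitName_preimage_singleton (T : X → X) (A : X → κ) (n : ℕ) (g : Fin n → κ) :
    orbitName T A n ⁻¹' {g} = ⋂ i : Fin n, T^[(i : ℕ)] ⁻¹' (A ⁻¹' {g i}) := by
  ext x
  simp [orbitName, funext_iff]

theorem DiscMeas.orbitName [MeasurableSpace X] [Finite κ] {T : X → X} (hT : Measurable T)
    {A : X → κ} (hA : DiscMeas A) (n : ℕ) : DiscMeas (orbitName T A n) := by
  refine discMeas_of_singleton fun g => ?_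
  rw [orbitName_preimage_singleton]
  exact MeasurableSet.iInter fun i => (hT.iterate i) (hA _)

variable [Fintype κ]

theorem ent_orbitName_le [MeasurableSpace X] {μ : Measure X} [IsProbabilityMeasure μ] {T : X → X}
    (hT : MeasurePreserving T μ μ) {A : X → κ} (hA : DiscMeas A) (n : ℕ) :
    ent μ (orbitName T A n) ≤ n * ent μ A := by
  induction n with
  | zero =>
    have : orbitName T A 0 ⁻¹' {default} = univ := by
      ext x
      simp [eq_iff_true_of_subsingleton]
    simp [ent, this]
  | succ n ih =>
    have hm := hT.measurable
    have h1 : orbitName T A (n + 1) =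
        fun x => (fun p : (Fin n → κ) × κ => Fin.snoc (α := fun _ => κ) p.1 p.2)
          (orbitName T A n x, A (T^[n] x)) := by
      funext x i
      refine Fin.lastCases ?_ (fun i => ?_) i <;> simp [orbitName]
    have hAn : DiscMeas fun x => A (T^[n] x) := hA.comp_right (hm.iterate n)
    calc ent μ (orbitName T A (n + 1))
        ≤ ent μ fun x => (orbitName T A n x, A (T^[n] x)) := by
          rw [h1]
          exact ent_comp_le μ (Z := fun x => (orbitName T A n x, A (T^[n] x)))
            ((hA.orbitName hm n).prodMk hAn) fun p => Fin.snoc (α := fun _ => κ) p.1 p.2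
      _ ≤ ent μ (orbitName T A n) + ent μ fun x => A (T^[n] x) :=
          ent_prod_le μ (hA.orbitName hm n) hAn
      _ ≤ n * ent μ A + ent μ A := by
          gcongr
          exact (ent_comp_measurePreserving (hT.iterate n) hA).le
      _ = _ := by push_cast; ring

/-- A label map agrees, off a set carrying little entropy, with one whose fibres are uniformly
apart. -/
theorem exists_separated_core [MetricSpace X] [CompactSpace X] [MeasurableSpace X] [BorelSpace X]
    (μ : Measure X) [IsProbabilityMeasure μ] {A : X → κ} (hA : DiscMeas A) {η : ℝ} (hη : 0 < η) :
    ∃ (G : X → Option κ) (δ : ℝ), 0 < δ ∧ DiscMeas G ∧ ent μ G ≤ η ∧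
      ∀ x y, G x = G y → A x ≠ A y → δ < dist x y := by
  classical
  set N : ℝ := Fintype.card κ + 1 with hN
  have hN0 : 0 < N := by positivity
  obtain ⟨ρ, hρ, h0, h1⟩ : ∃ ρ > 0, (∀ t : ℝ, |t| < ρ → Real.negMulLog t < η / N) ∧
      ∀ t : ℝ, |t - 1| < ρ → Real.negMulLog t < η / N := by
    have hc := Real.continuous_negMulLog
    have hpos : 0 < η / N := by positivity
    have e0 := (hc.tendsto 0).eventually_lt_const (by simpa using hpos)
    have e1 := (hc.tendsto 1).eventually_lt_const (by simpa using hpos)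
    obtain ⟨r, hr, hr'⟩ := Metric.eventually_nhds_iff.1 e0
    obtain ⟨s, hs, hs'⟩ := Metric.eventually_nhds_iff.1 e1
    exact ⟨min r s, lt_min hr hs,
      fun t ht => hr' (by simpa [Real.dist_eq] using ht.trans_le (min_le_left _ _)),
      fun t ht => hs' (by simpa [Real.dist_eq] using ht.trans_le (min_le_right _ _))⟩
  have hB : ∀ k, ∃ B ⊆ A ⁻¹' {k}, IsCompact B ∧ μ (A ⁻¹' {k} \ B) < ENNReal.ofReal (ρ / N) :=
    fun k => (hA {k}).exists_isCompact_sdiff_lt (measure_ne_top _ _)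
      (by simpa using div_pos hρ hN0)
  choose B hBA hBc hBμ using hB
  set C : Set X := ⋃ k, B k with hC
  set G : X → Option κ := fun x => if x ∈ C then none else some (A x) with hG
  have hmemC : ∀ {x}, x ∈ C ↔ x ∈ B (A x) := fun {x} =>
    ⟨fun h => by
      obtain ⟨k, hk⟩ := mem_iUnion.1 h
      have : A x = k := hBA k hk
      rwa [this], fun h => mem_iUnion.2 ⟨_, h⟩⟩
  have hGs : ∀ k, G ⁻¹' {some k} = A ⁻¹' {k} \ B k := fun k => by
    ext x
    by_cases hx : x ∈ C
    · have hx' := hmemC.1 hx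
      simp only [hG, mem_preimage, hx, if_true, mem_singleton_iff, Set.mem_sdiff]
      constructor
      · intro h; cases h
      · rintro ⟨rfl, h⟩; exact absurd hx' h
    · have hx' := fun h => hx (hmemC.2 h)
      simp only [hG, mem_preimage, hx, if_false, mem_singleton_iff, Set.mem_sdiff, Option.some.injEq]
      constructor
      · rintro rfl; exact ⟨rfl, hx'⟩
      · exact fun h => h.1
  have hGn : G ⁻¹' {none} = C := by
    ext x
    by_cases hx : x ∈ C <;> simp [hG, hx]
  have hGm : DiscMeas G := discMeas_of_singleton fun o => by
    cases o with
    | none => rw [hGn]; exact MeasurableSet.iUnion fun k => (hBc k).measurableSet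
    | some k => rw [hGs]; exact (hA _).diff (hBc k).measurableSet
  have hsmall : ∀ k, μ.real (G ⁻¹' {some k}) < ρ / N := fun k => by
    rw [hGs]
    exact (ENNReal.lt_ofReal_iff_toReal_lt (measure_ne_top _ _)).1 (hBμ k)
  have htot : μ.real (G ⁻¹' {none}) + ∑ k, μ.real (G ⁻¹' {some k}) = 1 := by
    rw [← Fintype.sum_option fun o => μ.real (G ⁻¹' {o}), sum_real_fiber μ hGm]
    simp
  have hlt : ∑ k, μ.real (G ⁻¹' {some k}) < ρ := by
    calc _ ≤ ∑ _k : κ, ρ / N := Finset.sum_le_sum fun k _ => (hsmall k).le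
      _ = (N - 1) * (ρ / N) := by simp [hN]
      _ < ρ := by
        rw [sub_mul, mul_div_cancel₀ _ hN0.ne']
        linarith [div_pos hρ hN0]
  have hent : ent μ G ≤ η := by
    unfold ent
    rw [Fintype.sum_option]
    have a1 : Real.negMulLog (μ.real (G ⁻¹' {none})) ≤ η / N := by
      refine (h1 _ ?_).le
      rw [abs_lt]
      have : 0 ≤ ∑ k, μ.real (G ⁻¹' {some k}) :=
        Finset.sum_nonneg fun _ _ => measureReal_nonneg
      constructor <;> linarith
    have hN1 : 1 ≤ N := by simp [hN]
    have a2 : ∑ k, Real.negMulLog (μ.real (G ⁻¹' {some k})) ≤ ∑ _k : κ, η / N :=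
      Finset.sum_le_sum fun k _ => (h0 _ (by
        rw [abs_of_nonneg measureReal_nonneg]
        exact (hsmall k).trans_le (div_le_self hρ.le hN1))).le
    have a3 : ∑ _k : κ, η / N = (N - 1) * (η / N) := by simp [hN]
    have a4 : η / N + (N - 1) * (η / N) = η := by field_simp; ring
    linarith
  have hsep : ∀ᶠ δ in 𝓝[>] (0 : ℝ), ∀ p : κ × κ, p.1 ≠ p.2 → ∀ x ∈ B p.1, ∀ y ∈ B p.2,
      δ < dist x y := by
    rw [eventually_all]
    rintro ⟨k, l⟩
    by_cases hkl : k = l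
    · simp [hkl]
    have hd : Disjoint (B k) (B l) := disjoint_left.2 fun x hk hl =>
      hkl ((hBA k hk).symm.trans (hBA l hl))
    obtain ⟨δ, hδ, hdis⟩ := hd.exists_thickenings (hBc k) (hBc l).isClosed
    filter_upwards [Ioo_mem_nhdsGT hδ] with δ' hδ' _ x hx y hy
    by_contra hle
    exact disjoint_left.1 hdis (Metric.mem_thickening_iff.2 ⟨x, hx, by
      rw [dist_comm]; exact (not_lt.1 hle).trans_lt hδ'.2⟩)
      (Metric.self_subset_thickening hδ _ hy)
  obtain ⟨δ, hδ, hδ0⟩ := (hsep.and self_mem_nhdsWithin).exists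
  refine ⟨G, δ, hδ0, hGm, hent, fun x y hxy hne => ?_⟩
  by_cases hx : x ∈ C <;> by_cases hy : y ∈ C <;> simp only [hG, hx, hy, if_true, if_false] at hxy
  · exact hδ (A x, A y) hne x (hmemC.1 hx) y (hmemC.1 hy)
  · cases hxy
  · cases hxy
  · exact absurd (Option.some.inj hxy) hne

theorem exists_ge_increment {u : ℕ → ℝ} {h : ℝ} (hu : ∀ N : ℕ, N * h ≤ u N) {n : ℕ} (hn : 0 < n)
    {η : ℝ} (hη : 0 < η) (m₀ : ℕ) : ∃ m ≥ m₀, n * (h - η) ≤ u (n + m) - u m := by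
  by_contra! hcon
  have hk : ∀ k : ℕ, u (k * n + m₀) ≤ u m₀ + k * (n * (h - η)) := by
    intro k
    induction k with
    | zero => simp
    | succ k ih =>
      have := hcon (k * n + m₀) (Nat.le_add_left _ _)
      rw [show n + (k * n + m₀) = (k + 1) * n + m₀ by ring] at this
      push_cast
      linarith
  have hn' : (0 : ℝ) < n := by exact_mod_cast hn
  obtain ⟨k, hk'⟩ := exists_nat_gt ((u m₀ - m₀ * h) / (n * η))
  rw [div_lt_iff₀ (by positivity)] at hk'
  have h1 := hk k
  have h2 := hu (k * n + m₀)
  push_cast at h2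
  nlinarith

/-- The set of points whose `m`-cylinder has a preimage under `T^n` with large separated sums has
measure bounded below. -/
theorem real_le_of_increment [MetricSpace X] [CompactSpace X] [MeasurableSpace X] [BorelSpace X]
    {T : X → X} (hT : Continuous T) (f : C(X, ℝ)) {μ : Measure X} [IsProbabilityMeasure μ]
    (hμ : MeasurePreserving T μ μ) {A : X → κ} (hA : DiscMeas A) {G : X → Option κ}
    (hG : DiscMeas G) {δ : ℝ} (hδ : 0 < δ)
    (hAG : ∀ x y, G x = G y → A x ≠ A y → δ < dist x y) {M : ℝ}
    (hM : ∀ n E, IsSepFinset T n δ E → ∑ x ∈ E, Real.exp (birk T f n x) ≤ Real.exp (n * M))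
    {c : ℝ} (n m : ℕ) :
    ent μ (orbitName T A (n + m)) - ent μ (orbitName T A m) + n * ∫ x, f x ∂μ
      - n * ent μ G - 1 ≤ n * c + n * (M - c) * μ.real {x | Real.exp (n * c) ≤
        sepPn T f n δ (T^[n] ⁻¹' {y | orbitName T A m y = orbitName T A m x})} := by
  classical
  have hTm := hT.measurable
  set Z : X → (Fin m → κ) := fun x => orbitName T A m (T^[n] x) with hZ
  set W := orbitName T G n with hW
  set V := orbitName T A n with hV
  have hB : ∀ x, |f x| ≤ ‖f‖ := fun x => f.norm_coe_le_norm x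
  have hZm : DiscMeas Z := (hA.orbitName hTm m).comp_right (hTm.iterate n)
  have hWm : DiscMeas W := hG.orbitName hTm n
  have hVm : DiscMeas V := hA.orbitName hTm n
  have hUm := hZm.prodMk hWm
  set P : (Fin m → κ) × (Fin n → Option κ) → ℝ := fun u =>
    if (Z ⁻¹' {u.1}).Nonempty then sepPn T f n δ (Z ⁻¹' {u.1}) else 1 with hP
  have hPpos : ∀ u, 0 < P u := fun u => by
    by_cases h : (Z ⁻¹' {u.1}).Nonempty
    · simpa only [hP, h, if_true] using sepPn_pos hδ hB n h
    · simp [hP, h]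
  have hcont : Continuous (birk T f n) := continuous_birk hT f.continuous n
  have hint : Integrable (birk T f n) μ :=
    hcont.integrable_of_hasCompactSupport (HasCompactSupport.of_compactSpace _)
  have hmain := ent_add_integral_le μ hUm hVm hint
    (fun x => (le_abs_self _).trans (abs_birk_le hB n x)) P hPpos (by
      intro u E hEU hEV
      rcases E.eq_empty_or_nonempty with rfl | ⟨x₀, hx₀⟩
      · simpa using (hPpos u).le
      have hZu : ∀ x ∈ E, Z x = u.1 := fun x hx => congrArg Prod.fst (hEU x hx)
      have hne : (Z ⁻¹' {u.1}).Nonempty := ⟨x₀, hZu x₀ hx₀⟩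
      simp only [hP, hne, if_true]
      refine sum_le_sepPn hδ hB (fun x hx => hZu x hx) fun x hx y hy hxy => ?_
      have hWxy : W x = W y := congrArg Prod.snd ((hEU x hx).trans (hEU y hy).symm)
      by_contra! hd
      refine hxy (hEV x hx y hy (orbitName_eq_iff.2 fun i hi => ?_))
      by_contra hne'
      exact (hAG _ _ (orbitName_eq_iff.1 hWxy i hi) hne').not_ge (hd i hi))
  rw [integral_birk hT hμ f n] at hmain
  have hjoin : ent μ (orbitName T A (n + m)) ≤ ent μ fun x => ((Z x, W x), V x) := by
    have : orbitName T A (n + m) = fun x =>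
        (fun p : ((Fin m → κ) × (Fin n → Option κ)) × (Fin n → κ) => Fin.append p.2 p.1.1)
          ((Z x, W x), V x) := by
      funext x i
      refine Fin.addCases (fun i => ?_) (fun i => ?_) i
      · simp [orbitName, hV]
      · simp [orbitName, hZ, ← Function.iterate_add_apply, add_comm]
    rw [this]
    exact ent_comp_le μ (Z := fun x => ((Z x, W x), V x)) (hUm.prodMk hVm)
      fun p : ((Fin m → κ) × (Fin n → Option κ)) × (Fin n → κ) => Fin.append p.2 p.1.1
  have hU : ent μ (fun x => (Z x, W x)) ≤ ent μ (orbitName T A m) + n * ent μ G :=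
    (ent_prod_le μ hZm hWm).trans (add_le_add
      (ent_comp_measurePreserving (hμ.iterate n) (hA.orbitName hTm m)).le
      (ent_orbitName_le hμ hG n))
  set S : Set X := {x | Real.exp (n * c) ≤
        sepPn T f n δ (T^[n] ⁻¹' {y | orbitName T A m y = orbitName T A m x})} with hS
  set Q : Finset ((Fin m → κ) × (Fin n → Option κ)) :=
    Finset.univ.filter fun u => Real.exp (n * c) ≤ sepPn T f n δ (Z ⁻¹' {u.1}) with hQ
  have hSm : MeasurableSet S := hA.orbitName hTm m
    {a | Real.exp (n * c) ≤ sepPn T f n δ (T^[n] ⁻¹' {y | orbitName T A m y = a})}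
  have hQS : ∑ u ∈ Q, μ.real ((fun x => (Z x, W x)) ⁻¹' {u}) = μ.real S := by
    rw [sum_real_fiber μ hUm, ← (hμ.iterate n).measureReal_preimage hSm.nullMeasurableSet]
    congr 1
    ext x
    simp only [hQ, Finset.coe_filter, Finset.mem_univ, true_and, mem_preimage, mem_ofPred_eq, hS]
    rfl
  have htot : ∑ u, μ.real ((fun x => (Z x, W x)) ⁻¹' {u}) = 1 := by
    rw [sum_real_fiber μ hUm]
    simp
  have hsum : ∑ u, μ.real ((fun x => (Z x, W x)) ⁻¹' {u}) * Real.log (P u) ≤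
      n * c + n * (M - c) * μ.real S := by
    rw [← hQS, ← mul_one ((n : ℝ) * c), ← htot, Finset.mul_sum, Finset.mul_sum, hQ,
      Finset.sum_filter, ← Finset.sum_add_distrib]
    refine Finset.sum_le_sum fun u _ => ?_
    have hw : 0 ≤ μ.real ((fun x => (Z x, W x)) ⁻¹' {u}) := measureReal_nonneg
    by_cases hne : (Z ⁻¹' {u.1}).Nonempty
    · have hPu : P u = sepPn T f n δ (Z ⁻¹' {u.1}) := by simp only [hP, hne, if_true]
      split_ifs with hc
      · have : Real.log (P u) ≤ n * M := by
          rw [Real.log_le_iff_le_exp (hPpos u), hPu]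
          exact sepPn_le fun E _ hE => hM n E hE
        nlinarith
      · have : Real.log (P u) ≤ n * c := by
          rw [Real.log_le_iff_le_exp (hPpos u), hPu]
          exact (not_le.1 hc).le
        nlinarith
    · have : (fun x => (Z x, W x)) ⁻¹' {u} = ∅ := by
        rw [← not_nonempty_iff_eq_empty]
        rintro ⟨x, hx⟩
        exact hne ⟨x, congrArg Prod.fst hx⟩
      simp [this]
  linarith

/-- A labelling of small mesh with positive free energy above `c` forces a set of positive measure
of points with exponential lower bound `c` along preimages of the `ε`-stable set. -/
theorem exists_positive_measure_set [MetricSpace X] [CompactSpace X] [MeasurableSpace X]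
    [BorelSpace X] {T : X → X} (hT : Continuous T) (f : C(X, ℝ)) {μ : Measure X}
    [IsProbabilityMeasure μ] (hμ : MeasurePreserving T μ μ) {A : X → κ} (hA : DiscMeas A) {ε : ℝ}
    (hmesh : ∀ x y, A x = A y → dist x y ≤ ε) {h : ℝ}
    (hh : ∀ N : ℕ, N * h ≤ ent μ (orbitName T A N)) {c : ℝ} (hc : c < h + ∫ x, f x ∂μ) :
    ∃ δ > 0, ∃ S : Set X, MeasurableSet S ∧ μ S ≠ 0 ∧
      ∀ x ∈ S, ∃ᶠ n : ℕ in atTop,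
        Real.exp (n * c) ≤ sepPn T f n δ (T^[n] ⁻¹' epsStable T ε x) := by
  obtain ⟨η, hη, hceq⟩ : ∃ η > 0, h + ∫ x, f x ∂μ = c + 5 * η :=
    ⟨(h + ∫ x, f x ∂μ - c) / 5, by linarith, by ring⟩
  have hB : ∀ x, |f x| ≤ ‖f‖ := fun x => f.norm_coe_le_norm x
  obtain ⟨G, δ, hδ, hG, hGent, hAG⟩ := exists_separated_core μ hA hη
  obtain ⟨M₀, hM₀⟩ := exists_sum_sep_le hδ T hB
  obtain ⟨M, hM, hcM⟩ : ∃ M : ℝ, (∀ n E, IsSepFinset T n δ E →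
      ∑ x ∈ E, Real.exp (birk T f n x) ≤ Real.exp (n * M)) ∧ c + η < M :=
    ⟨max M₀ (c + 2 * η), fun n E hE => (hM₀ n E hE).trans (by gcongr; exact le_max_left _ _),
      lt_max_of_lt_right (by linarith)⟩
  set S : ℕ → ℕ → Set X := fun n m => {x | Real.exp (n * (c + η)) ≤
    sepPn T f n δ (T^[n] ⁻¹' {y | orbitName T A m y = orbitName T A m x})} with hS
  have hSm : ∀ n m, MeasurableSet (S n m) := fun n m => hA.orbitName hT.measurable m
    {a | Real.exp (n * (c + η)) ≤ sepPn T f n δ (T^[n] ⁻¹' {y | orbitName T A m y = a})}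
  have hSa : ∀ n, Antitone (S n) := fun n m m' hmm x hx =>
    le_trans hx (sepPn_mono hδ hB n (preimage_mono fun y hy =>
      orbitName_eq_iff.2 fun i hi => orbitName_eq_iff.1 hy i (hi.trans_le hmm)))
  set p := η / (M - (c + η)) with hp
  have hp0 : 0 < p := div_pos hη (by linarith)
  have hev : ∀ᶠ n : ℕ in atTop, 1 ≤ n * η := by
    filter_upwards [(tendsto_natCast_atTop_atTop (R := ℝ)).eventually_ge_atTop (1 / η)] with n hn
    rwa [div_le_iff₀ hη] at hn
  have hlow : ∀ n : ℕ, 1 ≤ n * η → ∀ m, ENNReal.ofReal p ≤ μ (S n m) := by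
    intro n hn m₀
    have hn0 : 0 < n := Nat.pos_of_ne_zero fun h0 => by simp [h0] at hn; linarith
    have hn' : (0 : ℝ) < n := by exact_mod_cast hn0
    obtain ⟨m, hm, hinc⟩ := exists_ge_increment hh hn0 hη m₀
    refine le_trans ?_ (measure_mono (hSa n hm))
    rw [ENNReal.ofReal_le_iff_le_toReal (measure_ne_top _ _)]
    have key := real_le_of_increment hT f hμ hA hG hδ hAG hM (c := c + η) n m
    have h1 : (n : ℝ) * ent μ G ≤ n * η := by gcongr
    have h2 : (n : ℝ) * (h + ∫ x, f x ∂μ) = n * (c + 5 * η) := by rw [hceq]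
    rw [hp, div_le_iff₀ (by linarith)]
    have h3 : (n : ℝ) * η ≤ n * ((M - (c + η)) * μ.real (S n m)) := by
      simp only [hS]
      nlinarith
    have h4 := le_of_mul_le_mul_left h3 hn'
    rw [mul_comm]
    exact h4
  have hlow' : ∀ n : ℕ, 1 ≤ n * η → ENNReal.ofReal p ≤ μ (⋂ m, S n m) := by
    intro n hn
    rw [(hSa n).measure_iInter (fun m => (hSm n m).nullMeasurableSet) ⟨0, measure_ne_top _ _⟩]
    exact le_iInf (hlow n hn)
  set R : ℕ → Set X := fun N => ⋃ n ≥ N, ⋂ m, S n m with hR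
  have hRm : ∀ N, MeasurableSet (R N) := fun N => MeasurableSet.iUnion fun n =>
    MeasurableSet.iUnion fun _ => MeasurableSet.iInter fun m => hSm n m
  refine ⟨δ / 2, half_pos hδ, ⋂ N, R N, MeasurableSet.iInter hRm, ?_, fun x hx => ?_⟩
  · rw [Antitone.measure_iInter
      (fun N N' hN => biUnion_subset_biUnion_left fun n hn => hN.trans hn)
      (fun N => (hRm N).nullMeasurableSet) ⟨0, measure_ne_top _ _⟩]
    refine ((ENNReal.ofReal_pos.2 hp0).trans_le (le_iInf fun N => ?_)).ne'
    obtain ⟨n, hn, hnN⟩ := (hev.and (eventually_ge_atTop N)).exists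
    exact (hlow' n hn).trans (measure_mono (subset_biUnion_of_mem (u := fun n => ⋂ m, S n m) hnN))
  · have hfreq : ∃ᶠ n in atTop, x ∈ ⋂ m, S n m := frequently_atTop.2 fun N => by
      obtain ⟨n, hn, hxn⟩ := mem_iUnion₂.1 (mem_iInter.1 hx N)
      exact ⟨n, hn, hxn⟩
    refine (hfreq.and_eventually hev).mono fun n ⟨hxn, hn⟩ => ?_
    have h1 := le_sepPn_epsStable hδ hT f.continuous hB n ε x (R := Real.exp (n * (c + η)))
      fun m => le_trans (mem_iInter.1 hxn m) (sepPn_mono hδ hB n (preimage_mono fun y hy i hi =>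
        hmesh _ _ (orbitName_eq_iff.1 hy i hi).symm))
    have h2 : Real.exp (n * (c + η)) = Real.exp 1 * Real.exp (n * (c + η) - 1) := by
      rw [← Real.exp_add]
      congr 1
      ring
    rw [h2] at h1
    exact (Real.exp_le_exp.2 (by linarith)).trans (le_of_mul_le_mul_left h1 (Real.exp_pos 1))

end Names

section Pressure

theorem exists_small_mesh [MetricSpace X] [CompactSpace X] [MeasurableSpace X] [BorelSpace X]
    {ε : ℝ} (hε : 0 < ε) :
    ∃ (t : Finset X) (D : X → t → Bool), DiscMeas D ∧ ∀ x y, D x = D y → dist x y ≤ ε := by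
  obtain ⟨t, -, htf, ht⟩ := (isCompact_univ (X := X)).finite_cover_balls (half_pos hε)
  refine ⟨htf.toFinset, fun x c => decide (dist x c < ε / 2), ?_, fun x y hxy => ?_⟩
  · refine discMeas_of_singleton fun g => ?_
    have : (fun (x : X) (c : htf.toFinset) => decide (dist x c < ε / 2)) ⁻¹' {g} =
        ⋂ c : htf.toFinset, {x | decide (dist x (c : X) < ε / 2) = g c} := by
      ext x
      simp [funext_iff]
    rw [this]
    refine MeasurableSet.iInter fun c => ?_
    have hball : MeasurableSet {x : X | dist x c < ε / 2} := measurableSet_ball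
    cases g c
    · convert hball.compl using 1
      ext x
      simp
    · simpa using hball
  · obtain ⟨c, hc, hxc⟩ := mem_iUnion₂.1 (ht (mem_univ x))
    have h := congrFun hxy ⟨c, htf.mem_toFinset.2 hc⟩
    simp only [decide_eq_decide] at h
    have h1 : dist x c < ε / 2 := hxc
    have := dist_triangle_right x y c
    linarith [h.1 h1]

/-- A finite partition yields a labelling by its atoms with the same iterated entropies. -/
theorem IsFinPartition.exists_label [MeasurableSpace X] {α : Finset (Set X)}
    (hα : IsFinPartition α) :
    ∃ A : X → α, DiscMeas A ∧
      ∀ (μ : Measure X) (T : X → X) (n : ℕ), ent μ (orbitName T A n) = dynH μ T α n := by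
  have hex : ∀ x : X, ∃ a : α, x ∈ (a : Set X) := fun x => by
    obtain ⟨a, ha, hx⟩ := mem_sUnion.1 (hα.2.1 ▸ mem_univ x)
    exact ⟨⟨a, ha⟩, hx⟩
  choose A hA using hex
  have hpre : ∀ a : α, A ⁻¹' {a} = a := fun a => by
    ext x
    refine ⟨fun h => by simpa only [← mem_singleton_iff.1 h] using hA x, fun hx => ?_⟩
    by_contra hne
    exact disjoint_left.1 (hα.2.2 (A x).2 a.2 fun h => hne (Subtype.ext h)) (hA x) hx
  refine ⟨A, discMeas_of_singleton fun a => by rw [hpre]; exact hα.1 a a.2, fun μ T n => ?_⟩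
  refine Finset.sum_congr rfl fun g _ => ?_
  rw [orbitName_preimage_singleton]
  simp only [hpre]
  rfl

theorem mul_entPart_le [MeasurableSpace X] (μ : Measure X) [IsProbabilityMeasure μ] (T : X → X)
    (α : Finset (Set X)) (n : ℕ) : n * entPart μ T α ≤ dynH μ T α n := by
  have h0 : ∀ k, 0 ≤ dynH μ T α k := fun k => Finset.sum_nonneg fun g _ =>
    Real.negMulLog_nonneg ENNReal.toReal_nonneg measureReal_le_one
  cases n with
  | zero => simpa using h0 0
  | succ n =>
    have hb : BddBelow (range fun n : ℕ => dynH μ T α (n + 1) / (n + 1 : ℝ)) :=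
      ⟨0, by rintro _ ⟨k, rfl⟩; exact div_nonneg (h0 _) (by positivity)⟩
    have := ciInf_le hb n
    rw [le_div_iff₀ (by positivity)] at this
    push_cast
    rw [mul_comm]
    exact this

theorem le_Ps_of_frequently [MetricSpace X] {T : X → X} {f : X → ℝ} {x : X} {ε δ c : ℝ}
    (hδ : 0 < δ) (h : ∃ᶠ n : ℕ in atTop,
      Real.exp (n * c) ≤ sepPn T f n δ (T^[n] ⁻¹' epsStable T ε x)) :
    (c : EReal) ≤ Ps T f x ε := by
  refine le_trans ?_ (le_iSup₂ (f := fun (δ : ℝ) (_ : 0 < δ) => atTop.limsup fun n : ℕ =>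
    ((Real.log (sepPn T f n δ ((T^[n]) ⁻¹' epsStable T ε x)) / n : ℝ) : EReal)) δ hδ)
  refine le_limsup_of_frequently_le ((h.and_eventually (eventually_gt_atTop 0)).mono ?_)
  rintro n ⟨hn, hn0⟩
  have hn' : (0 : ℝ) < n := by exact_mod_cast hn0
  rw [EReal.coe_le_coe_iff, le_div_iff₀ hn', mul_comm,
    Real.le_log_iff_exp_le ((Real.exp_pos _).trans_le hn)]
  exact hn

theorem Ps_mono [MetricSpace X] [CompactSpace X] {T : X → X} {f : X → ℝ} {B : ℝ}
    (hB : ∀ x, |f x| ≤ B) (hTs : Function.Surjective T) (x : X) {ε ε' : ℝ} (hε : 0 ≤ ε)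
    (hεε' : ε ≤ ε') : Ps T f x ε ≤ Ps T f x ε' := by
  refine iSup₂_mono fun δ hδ => limsup_le_limsup (Eventually.of_forall fun n => ?_)
  have hsub : epsStable T ε x ⊆ epsStable T ε' x := fun y hy j => (hy j).trans hεε'
  obtain ⟨y, hy⟩ := hTs.iterate n x
  have hne : (T^[n] ⁻¹' epsStable T ε x).Nonempty := ⟨y, fun j => by rw [hy, dist_self]; exact hε⟩
  rw [EReal.coe_le_coe_iff]
  gcongr
  · exact sepPn_pos hδ hB n hne
  · exact sepPn_mono hδ hB n (preimage_mono hsub)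

/-- Exponential lower bounds propagate along orbits, at the cost of the rate. -/
theorem frequently_sepPn_iterate [MetricSpace X] [CompactSpace X] {T : X → X} {f : X → ℝ} {B : ℝ}
    (hB : ∀ x, |f x| ≤ B) {δ : ℝ} (hδ : 0 < δ) {ε c c' : ℝ} (hc : c' < c) (k : ℕ) {x : X}
    (h : ∃ᶠ n : ℕ in atTop, Real.exp (n * c) ≤ sepPn T f n δ (T^[n] ⁻¹' epsStable T ε x)) :
    ∃ᶠ n : ℕ in atTop,
      Real.exp (n * c') ≤ sepPn T f n δ (T^[n] ⁻¹' epsStable T ε (T^[k] x)) := by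
  have hev : ∀ᶠ n : ℕ in atTop, k * (c' + B) ≤ n * (c - c') := by
    filter_upwards [(tendsto_natCast_atTop_atTop (R := ℝ)).eventually_ge_atTop
      (k * (c' + B) / (c - c'))] with n hn
    rwa [div_le_iff₀ (sub_pos.2 hc)] at hn
  refine (tendsto_add_atTop_nat k).frequently ((h.and_eventually hev).mono ?_)
  rintro n ⟨hn, hn'⟩
  refine le_trans ?_ (sepPn_iterate_ge hδ hB n k ε x)
  refine le_trans ?_ (mul_le_mul_of_nonneg_left hn (Real.exp_pos _).le)
  rw [← Real.exp_add, Real.exp_le_exp]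
  push_cast
  linarith

theorem ae_le_Ps [MetricSpace X] [CompactSpace X] [MeasurableSpace X] [BorelSpace X] {T : X → X}
    (hT : Continuous T) (f : C(X, ℝ)) {μ : Measure X} [IsProbabilityMeasure μ]
    (herg : Ergodic T μ) {q : ℝ} (hq : (q : EReal) < mPres μ T f) {ε : ℝ} (hε : 0 < ε) :
    ∀ᵐ x ∂μ, (q : EReal) ≤ Ps T f x ε := by
  classical
  have hent : ((q - ∫ x, f x ∂μ : ℝ) : EReal) < mEnt μ T := by
    by_contra! hle
    refine hq.not_ge ((add_le_add_left hle _).trans_eq ?_)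
    rw [← EReal.coe_add, sub_add_cancel]
  obtain ⟨α, hα, hqα⟩ : ∃ α, IsFinPartition α ∧ q - ∫ x, f x ∂μ < entPart μ T α := by
    simpa only [mEnt, lt_iSup_iff, EReal.coe_lt_coe_iff, exists_prop] using hent
  obtain ⟨c, hqc, hc⟩ := exists_between (sub_lt_iff_lt_add.1 hqα)
  obtain ⟨A₀, hA₀, hA₀e⟩ := hα.exists_label
  obtain ⟨t, D, hD, hDmesh⟩ := exists_small_mesh (X := X) hε
  have hA := hA₀.prodMk hD
  have hh : ∀ N : ℕ, N * entPart μ T α ≤ ent μ (orbitName T (fun x => (A₀ x, D x)) N) := by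
    intro N
    refine (mul_entPart_le μ T α N).trans ?_
    rw [← hA₀e]
    exact ent_comp_le μ (hA.orbitName hT.measurable N) fun g i => (g i).1
  obtain ⟨δ, hδ, S, hSm, hS0, hS⟩ := exists_positive_measure_set hT f herg.toMeasurePreserving hA
    (fun x y hxy => hDmesh x y (congrArg Prod.snd hxy)) hh hc
  obtain ⟨K, hKS, hK, hK0⟩ := hSm.exists_lt_isCompact (pos_iff_ne_zero.2 hS0)
  set J : Set X := ⋃ k : ℕ, T^[k] '' K
  have hJm : MeasurableSet J :=
    MeasurableSet.iUnion fun k => (hK.image (hT.iterate k)).measurableSet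
  have hJinv : J ⊆ T ⁻¹' J := by
    intro x hx
    obtain ⟨k, y, hy, rfl⟩ := mem_iUnion.1 hx
    exact mem_iUnion.2 ⟨k + 1, y, hy, Function.iterate_succ_apply' T k y⟩
  have hKJ : K ⊆ J := fun x hx => mem_iUnion.2 ⟨0, x, hx, rfl⟩
  have hJ1 : J =ᵐ[μ] univ := by
    refine (herg.ae_empty_or_univ_of_ae_le_preimage hJm.nullMeasurableSet
      hJinv.eventuallyLE).resolve_left fun h => ?_
    exact (hK0.trans_le (measure_mono hKJ)).ne' (ae_eq_empty.1 h)
  filter_upwards [hJ1.mem_iff] with x hx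
  obtain ⟨k, y, hy, rfl⟩ := mem_iUnion.1 (hx.2 (mem_univ x))
  exact le_Ps_of_frequently hδ
    (frequently_sepPn_iterate f.norm_coe_le_norm hδ hqc k (hS y (hKS hy)))

end Pressure

/-- For a surjective continuous (non-invertible) `T` on a
compact metric space, `f ∈ C(X,ℝ)` and an ergodic `T`-invariant Borel
probability measure `μ` with `h_μ(T) > 0`: for `μ`-a.e. `x`,
`lim_{ε→0} P_s(T,f,x,ε) ≥ P_μ(T,f)` (the limit being the infimum over `ε > 0`,
since `ε ↦ P_s(T,f,x,ε)` is nondecreasing). -/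
theorem stmt18 [MetricSpace X] [CompactSpace X] [MeasurableSpace X] [BorelSpace X]
    (T : X → X) (hT : Continuous T) (hTs : Function.Surjective T) (f : C(X, ℝ))
    (μ : Measure X) [IsProbabilityMeasure μ]
    (herg : Ergodic T μ) (hpos : 0 < mEnt μ T) :
    ∀ᵐ x ∂μ, mPres μ T ⇑f ≤ ⨅ (ε : ℝ) (_ : 0 < ε), Ps T ⇑f x ε := by
  have hrat : ∀ q : ℚ, ((q : ℝ) : EReal) < mPres μ T f →
      ∀ᵐ x ∂μ, ∀ n : ℕ, ((q : ℝ) : EReal) ≤ Ps T f x (1 / (n + 1)) := fun q hq =>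
    ae_all_iff.2 fun n => ae_le_Ps hT f herg hq (by positivity)
  have hall : ∀ᵐ x ∂μ, ∀ q : ℚ, ((q : ℝ) : EReal) < mPres μ T f →
      ∀ n : ℕ, ((q : ℝ) : EReal) ≤ Ps T f x (1 / (n + 1)) := by
    refine ae_all_iff.2 fun q => ?_
    by_cases hq : ((q : ℝ) : EReal) < mPres μ T f
    · filter_upwards [hrat q hq] with x hx _ using hx
    · exact Eventually.of_forall fun x h => absurd h hq
  filter_upwards [hall] with x hx
  refine le_iInf₂ fun ε hε => ?_
  by_contra! hlt
  obtain ⟨q, hq1, hq2⟩ := EReal.exists_rat_btwn_of_lt hlt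
  obtain ⟨n, hn⟩ := exists_nat_one_div_lt hε
  exact absurd ((hx q hq2 n).trans (Ps_mono f.norm_coe_le_norm hTs x (by positivity) hn.le))
    (not_le.2 hq1)
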